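/- For every m ∈ ℕ there exist constants c_m, C_m > 0 such that for every smooth axisymmetric f : ℝ³ → ℝ and every x ∈ U: c_m · Σ_{|𝔐|=m} (𝒟^𝔐 f(x))² ≤ |∇^m f(x)|² ≤ C_m · Σ_{|𝔐|=m} (𝒟^𝔐 f(x))², where |∇^m f(x)|² := Σ_{(ι₁,…,ι_m)∈{r,θ,z}^m} (∇^m f(x)[e_{ι₁}(x),…,e_{ι_m}(x)])² and the left sum runs over all triples 𝔐=(m_c,m_r,m_z) of nonnegative integers with 2m_c+m_r+m_z=m. -/

import Mathlib

open MeasureTheory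

noncomputable section

abbrev R3 : Type := Fin 3 → ℝ

/-- cylindrical radius `r(x) = √(x₁² + x₂²)` -/
def rr (x : R3) : ℝ := Real.sqrt (x 0 ^ 2 + x 1 ^ 2)

/-- the region off the symmetry axis -/
def U : Set R3 := {x | 0 < rr x}

/-- partial derivative in coordinate direction `i` -/
def pd (i : Fin 3) (u : R3 → ℝ) : R3 → ℝ := fun x => fderiv ℝ u x (Pi.single i 1)

/-- angular derivative `∂_θ u = x₁ ∂₂ u − x₂ ∂₁ u` -/
def dTheta (u : R3 → ℝ) : R3 → ℝ := fun x => x 0 * pd 1 u x - x 1 * pd 0 u x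

/-- radial derivative `∂_r u = (x₁ ∂₁ u + x₂ ∂₂ u)/r` -/
def dR (u : R3 → ℝ) : R3 → ℝ := fun x => (x 0 * pd 0 u x + x 1 * pd 1 u x) / rr x

/-- vertical derivative `∂_z` -/
def dZ (u : R3 → ℝ) : R3 → ℝ := pd 2 u

/-- the operator `(1/r)∂_r` -/
def dRr (u : R3 → ℝ) : R3 → ℝ := fun x => dR u x / rr x

/-- axisymmetric: `∂_θ f = 0` on `U` -/
def axisym (f : R3 → ℝ) : Prop := ∀ x ∈ U, dTheta f x = 0

/-- radial unit vector -/
def er (x : R3) : R3 := ![x 0 / rr x, x 1 / rr x, 0]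
/-- azimuthal unit vector -/
def etheta (x : R3) : R3 := ![-(x 1) / rr x, x 0 / rr x, 0]
/-- vertical unit vector -/
def ez : R3 := ![0, 0, 1]

/-- the compound cylindrical derivative `𝒟^𝔐 = ∂_z^{m_z} ∘ ∂_r^{m_r} ∘ ((1/r)∂_r)^{m_c}` -/
def Dop (mc mr mz : ℕ) (f : R3 → ℝ) : R3 → ℝ := dZ^[mz] (dR^[mr] (dRr^[mc] f))

/-- the cylindrical frame: index `0 ↦ e_r`, `1 ↦ e_θ`, `2 ↦ e_z` -/
def frame (x : R3) : Fin 3 → R3 := ![er x, etheta x, ez]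

/-- multi-indices `𝔐 = (m_c, m_r, m_z)` with `|𝔐| = 2m_c + m_r + m_z = m` -/
def triples (m : ℕ) : Finset (ℕ × ℕ × ℕ) :=
  (Finset.range (m + 1) ×ˢ Finset.range (m + 1) ×ˢ Finset.range (m + 1)).filter
    (fun p => 2 * p.1 + p.2.1 + p.2.2 = m)

open scoped ContDiff

def Dv (v : R3) (u : R3 → ℝ) : R3 → ℝ := fun x => fderiv ℝ u x v

def itD (L : List R3) (f : R3 → ℝ) : R3 → ℝ := L.foldr Dv f

lemma Dv_smooth {u : R3 → ℝ} (hu : ContDiff ℝ ∞ u) (v : R3) : ContDiff ℝ ∞ (Dv v u) := by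
  have : ContDiff ℝ ∞ (fderiv ℝ u) := hu.fderiv_right (by simp)
  exact this.clm_apply contDiff_const

lemma itD_smooth {u : R3 → ℝ} (hu : ContDiff ℝ ∞ u) (L : List R3) : ContDiff ℝ ∞ (itD L u) := by
  induction L with
  | nil => exact hu
  | cons a l ih => exact Dv_smooth ih a

lemma Dv_Dv {u : R3 → ℝ} {x : R3} (hu : ContDiffAt ℝ ∞ u x) (v w : R3) :
    Dv v (Dv w u) x = fderiv ℝ (fderiv ℝ u) x v w := by
  have h1 : ContDiffAt ℝ 1 (fderiv ℝ u) x :=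
    hu.fderiv_right (m := 1) (by norm_num; exact WithTop.coe_le_coe.2 le_top)
  have h2 : DifferentiableAt ℝ (fderiv ℝ u) x := h1.differentiableAt (by simp)
  unfold Dv
  rw [fderiv_clm_apply h2 (by fun_prop)]
  simp

lemma Dv_comm {u : R3 → ℝ} {x : R3} (hu : ContDiffAt ℝ ∞ u x) (v w : R3) :
    Dv v (Dv w u) x = Dv w (Dv v u) x := by
  rw [Dv_Dv hu, Dv_Dv hu]
  exact (hu.isSymmSndFDerivAt (by simp; exact WithTop.coe_le_coe.2 le_top)).eq v w

lemma itD_perm {u : R3 → ℝ} (hu : ContDiff ℝ ∞ u) {L M : List R3} (h : L.Perm M) :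
    itD L u = itD M u := by
  induction h with
  | nil => rfl
  | cons a _ ih => change Dv a (itD _ u) = Dv a (itD _ u); rw [ih]
  | swap a b l =>
    change Dv b (Dv a (itD l u)) = Dv a (Dv b (itD l u))
    ext x
    exact Dv_comm (itD_smooth hu l).contDiffAt _ _
  | trans _ _ h1 h2 => exact h1.trans h2

lemma iter_itD {f : R3 → ℝ} (hf : ContDiff ℝ ∞ f) : ∀ (m : ℕ) (w : Fin m → R3) (x : R3),
    iteratedFDeriv ℝ m f x w = itD (List.ofFn w) f x := by
  intro m
  induction m with
  | zero => intro w x; simp [itD]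
  | succ n ih =>
    intro w x
    rw [iteratedFDeriv_succ_apply_left, List.ofFn_succ]
    change _ = fderiv ℝ (itD (List.ofFn fun i : Fin n => w i.succ) f) x (w 0)
    have : itD (List.ofFn fun i : Fin n => w i.succ) f
        = fun y => iteratedFDeriv ℝ n f y (Fin.tail w) := by
      ext y; rw [ih]; rfl
    rw [this]
    have hd : DifferentiableAt ℝ (iteratedFDeriv ℝ n f) x :=
      (hf.differentiable_iteratedFDeriv (by exact_mod_cast (ENat.natCast_lt_top n))) x
    rw [fderiv_continuousMultilinear_apply_const_apply hd]

lemma itD_replicate (f : R3 → ℝ) (e : R3) (b : ℕ) : itD (List.replicate b e) f = (Dv e)^[b] f := by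
  induction b with
  | zero => rfl
  | succ n ih =>
    rw [List.replicate_succ, Function.iterate_succ_apply', ← ih]; rfl

lemma Dv_iter_smooth {u : R3 → ℝ} (hu : ContDiff ℝ ∞ u) (e : R3) (n : ℕ) :
    ContDiff ℝ ∞ ((Dv e)^[n] u) := by
  rw [← itD_replicate]; exact itD_smooth hu _

lemma Dv_eq (v : R3) (u : R3 → ℝ) (x : R3) :
    Dv v u x = v 0 * pd 0 u x + v 1 * pd 1 u x + v 2 * pd 2 u x := by
  have : v = v 0 • Pi.single 0 1 + v 1 • Pi.single 1 1 + v 2 • (Pi.single 2 1 : R3) := by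
    ext i; fin_cases i <;> simp
  unfold Dv pd
  conv_lhs => rw [this]
  simp only [map_add, map_smul, smul_eq_mul]

lemma dR_eq (u : R3 → ℝ) (x : R3) : dR u x = Dv (er x) u x := by
  rw [Dv_eq]; simp [er, dR]; ring

lemma dZ_eq (u : R3 → ℝ) (x : R3) : dZ u x = Dv ez u x := by
  rw [Dv_eq]; simp [ez, dZ]

lemma mem_U {x : R3} : x ∈ U ↔ 0 < x 0 ^ 2 + x 1 ^ 2 := by
  simp [U, rr]

lemma rr_sq (x : R3) : rr x ^ 2 = x 0 ^ 2 + x 1 ^ 2 := by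
  unfold rr; rw [Real.sq_sqrt]; positivity

lemma isOpen_U : IsOpen U := by
  have : U = {x : R3 | 0 < x 0 ^ 2 + x 1 ^ 2} := by ext; exact mem_U
  rw [this]
  exact isOpen_lt (by fun_prop) (by fun_prop)

lemma pd_on {u : R3 → ℝ} (hu : ContDiffOn ℝ ∞ u U) (i : Fin 3) : ContDiffOn ℝ ∞ (pd i u) U := by
  have : ContDiffOn ℝ ∞ (fderiv ℝ u) U := hu.fderiv_of_isOpen isOpen_U (by simp)
  exact this.clm_apply contDiffOn_const

lemma rr_on : ContDiffOn ℝ ∞ rr U := by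
  unfold rr
  apply ContDiffOn.sqrt
  · fun_prop
  · intro x hx; exact (mem_U.1 hx).ne'

lemma rr_ne {x : R3} (hx : x ∈ U) : rr x ≠ 0 := ne_of_gt hx

lemma dR_on {u : R3 → ℝ} (hu : ContDiffOn ℝ ∞ u U) : ContDiffOn ℝ ∞ (dR u) U := by
  have h0 := pd_on hu 0
  have h1 := pd_on hu 1
  unfold dR
  refine ContDiffOn.div ?_ rr_on (fun x hx => rr_ne hx)
  refine ContDiffOn.add (ContDiffOn.mul (by fun_prop) h0) (ContDiffOn.mul (by fun_prop) h1)

lemma dRr_on {u : R3 → ℝ} (hu : ContDiffOn ℝ ∞ u U) : ContDiffOn ℝ ∞ (dRr u) U :=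
  ContDiffOn.div (dR_on hu) rr_on (fun x hx => rr_ne hx)

lemma iter_on {A : (R3 → ℝ) → (R3 → ℝ)} (hA : ∀ u, ContDiffOn ℝ ∞ u U → ContDiffOn ℝ ∞ (A u) U)
    (n : ℕ) {u : R3 → ℝ} (hu : ContDiffOn ℝ ∞ u U) : ContDiffOn ℝ ∞ (A^[n] u) U := by
  induction n with
  | zero => exact hu
  | succ n ih => rw [Function.iterate_succ_apply']; exact hA _ ih

lemma dRr_eq {u : R3 → ℝ} {x : R3} (hx : x ∈ U) :
    dRr u x = (x 0 * pd 0 u x + x 1 * pd 1 u x) / (x 0 ^ 2 + x 1 ^ 2) := by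
  unfold dRr dR
  rw [div_div, ← sq, rr_sq]

lemma pd0_eq {u : R3 → ℝ} (ha : axisym u) {x : R3} (hx : x ∈ U) : pd 0 u x = x 0 * dRr u x := by
  have h := ha x hx
  have h2 := (mem_U.1 hx).ne'
  unfold dTheta at h
  rw [dRr_eq hx]; field_simp; linear_combination -(x 1) * h

lemma pd1_eq {u : R3 → ℝ} (ha : axisym u) {x : R3} (hx : x ∈ U) : pd 1 u x = x 1 * dRr u x := by
  have h := ha x hx
  have h2 := (mem_U.1 hx).ne'
  unfold dTheta at h
  rw [dRr_eq hx]; field_simp; linear_combination (x 0) * h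

lemma pd_mul {g : R3 → ℝ} {x : R3} (hg : DifferentiableAt ℝ g x) (i j : Fin 3) (hij : i ≠ j) :
    pd i (fun y => y j * g y) x = x j * pd i g x := by
  unfold pd
  have hp : HasFDerivAt (fun y : R3 => y j) (ContinuousLinearMap.proj (R := ℝ) (φ := fun _ : Fin 3 => ℝ) j) x :=
    (ContinuousLinearMap.proj (R := ℝ) (φ := fun _ : Fin 3 => ℝ) j).hasFDerivAt
  have h : fderiv ℝ (fun y : R3 => y j * g y) x = _ := (hp.mul hg.hasFDerivAt).fderiv
  rw [h]
  simp [hij.symm]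

lemma dRr_axisym {u : R3 → ℝ} (hu : ContDiffOn ℝ ∞ u U) (ha : axisym u) : axisym (dRr u) := by
  intro x hx
  have hn : U ∈ nhds x := isOpen_U.mem_nhds hx
  have hd : DifferentiableAt ℝ (dRr u) x :=
    ((dRr_on hu).contDiffAt hn).differentiableAt (by simp)
  have e0 : pd 0 u =ᶠ[nhds x] fun y => y 0 * dRr u y := by
    filter_upwards [hn] with y hy using pd0_eq ha hy
  have e1 : pd 1 u =ᶠ[nhds x] fun y => y 1 * dRr u y := by
    filter_upwards [hn] with y hy using pd1_eq ha hy
  have s : pd 0 (pd 1 u) x = pd 1 (pd 0 u) x := Dv_comm (hu.contDiffAt hn) _ _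
  have a0 : pd 1 (pd 0 u) x = x 0 * pd 1 (dRr u) x := by
    rw [← pd_mul hd 1 0 (by decide)]; unfold pd at e0 ⊢; rw [e0.fderiv_eq]
  have a1 : pd 0 (pd 1 u) x = x 1 * pd 0 (dRr u) x := by
    rw [← pd_mul hd 0 1 (by decide)]; unfold pd at e1 ⊢; rw [e1.fderiv_eq]
  unfold dTheta
  linarith

def coef : ℕ → ℝ
  | 0 => 1
  | 1 => 0
  | (b + 2) => (b + 1) * coef b

lemma coef_even (k : ℕ) : 1 ≤ coef (2 * k) := by
  induction k with
  | zero => simp [coef]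
  | succ k ih =>
    change 1 ≤ coef (2 * k + 2)
    rw [coef]
    have : (0:ℝ) ≤ ((2 * k : ℕ) : ℝ) := by positivity
    nlinarith

lemma iter_mul {g : ℝ → ℝ} (hg : ContDiff ℝ ∞ g) (n : ℕ) :
    iteratedDeriv (n + 1) (fun t => t * g t)
      = fun t => t * iteratedDeriv (n + 1) g t + (n + 1) * iteratedDeriv n g t := by
  have hd : ∀ n t, HasDerivAt (iteratedDeriv n g) (iteratedDeriv (n + 1) g t) t := by
    intro n t
    rw [iteratedDeriv_succ]
    exact ((hg.differentiable_iteratedDeriv n (by exact_mod_cast (ENat.natCast_lt_top n))) t).hasDerivAt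
  induction n with
  | zero =>
    ext t
    rw [iteratedDeriv_succ, iteratedDeriv_zero]
    have h := (hasDerivAt_id t).mul (hd 0 t)
    have h2 : deriv (fun t => t * g t) t = _ := h.deriv
    rw [h2]; simp; ring
  | succ n ih =>
    ext t
    rw [iteratedDeriv_succ, ih]
    have h := ((hasDerivAt_id t).mul (hd (n + 1) t)).add ((hd n t).const_mul ((n : ℝ) + 1))
    have h2 := h.deriv
    refine Eq.trans h2 ?_
    simp; ring

lemma line_deriv {u : R3 → ℝ} {x e : R3} {t : ℝ} (hu : DifferentiableAt ℝ u (x + t • e)) :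
    HasDerivAt (fun s : ℝ => u (x + s • e)) (Dv e u (x + t • e)) t := by
  have h : HasDerivAt (fun s : ℝ => x + s • e) e t := by
    simpa using ((hasDerivAt_id t).smul_const e).const_add x
  exact hu.hasFDerivAt.comp_hasDerivAt t h

lemma line_iter {f : R3 → ℝ} (hf : ContDiff ℝ ∞ f) (x e : R3) (b : ℕ) :
    iteratedDeriv b (fun t : ℝ => f (x + t • e)) = fun t => (Dv e)^[b] f (x + t • e) := by
  induction b with
  | zero => simp
  | succ n ih =>
    rw [iteratedDeriv_succ, ih]
    ext t
    rw [Function.iterate_succ_apply']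
    exact (line_deriv ((Dv_iter_smooth hf e n).differentiable (by simp) _)).deriv

lemma line_mem {x : R3} (hx : x ∈ U) (t : ℝ) : x + t • etheta x ∈ U := by
  rw [mem_U]
  have h := rr_ne hx
  have h2 := mem_U.1 hx
  have : (x + t • etheta x) 0 ^ 2 + (x + t • etheta x) 1 ^ 2 = x 0 ^ 2 + x 1 ^ 2 + t ^ 2 := by
    have h3 := rr_sq x
    simp [etheta]
    field_simp
    linear_combination (-t^2) * h3
  rw [this]; positivity

lemma theta_iter : ∀ b : ℕ, ∀ u : R3 → ℝ, ContDiffOn ℝ ∞ u U → axisym u → ∀ x ∈ U,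
    iteratedDeriv b (fun t : ℝ => u (x + t • etheta x)) 0 = coef b * dRr^[b / 2] u x := by
  have key : ∀ u : R3 → ℝ, ContDiffOn ℝ ∞ u U → axisym u → ∀ x ∈ U,
      deriv (fun t : ℝ => u (x + t • etheta x)) = fun t => t * dRr u (x + t • etheta x) := by
    intro u hu ha x hx
    ext t
    have hm := line_mem hx t
    have hr := rr_ne hx
    have hd : DifferentiableAt ℝ u (x + t • etheta x) :=
      (hu.contDiffAt (isOpen_U.mem_nhds hm)).differentiableAt (by simp)
    rw [(line_deriv hd).deriv, Dv_eq, pd0_eq ha hm, pd1_eq ha hm]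
    have h3 := rr_sq x
    generalize dRr u (x + t • etheta x) = q
    simp [etheta]
    field_simp
    linear_combination -(t*q) * h3
  intro b
  induction b using Nat.twoStepInduction with
  | zero => intro u hu ha x hx; simp [coef]
  | one =>
    intro u hu ha x hx
    rw [iteratedDeriv_one, key u hu ha x hx]; simp [coef]
  | more n ih _ =>
    intro u hu ha x hx
    rw [iteratedDeriv_succ', key u hu ha x hx]
    have hs : ContDiff ℝ ∞ (fun t : ℝ => dRr u (x + t • etheta x)) := by
      refine (dRr_on hu).comp_contDiff (f := fun t : ℝ => x + t • etheta x) (by fun_prop) (fun t => line_mem hx t)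
    rw [iter_mul hs]
    simp only [zero_mul, zero_add]
    rw [ih _ (dRr_on hu) (dRr_axisym hu ha) x hx, coef]
    have : (n + 2) / 2 = n / 2 + 1 := by omega
    rw [this, Function.iterate_succ_apply]; ring

/-- the half plane through `x` -/
def HP (x : R3) : Set R3 := {y | y ∈ U ∧ er y = er x ∧ etheta y = etheta x}

lemma HP_r {x y : R3} (hy : y ∈ HP x) : ∀ᶠ t : ℝ in nhds 0, y + t • er x ∈ HP x := by
  obtain ⟨hU, h1, h2⟩ := hy
  rw [← h1]
  have hr : 0 < rr y := hU
  have ev : ∀ᶠ t : ℝ in nhds 0, -rr y < t := lt_mem_nhds (by linarith)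
  filter_upwards [ev] with t ht
  have hr' := hr.ne'
  have hp : 0 < 1 + t / rr y := by
    have : 1 + t / rr y = (rr y + t) / rr y := by field_simp
    rw [this]; apply div_pos <;> linarith
  have c0 : (y + t • er y) 0 = (1 + t / rr y) * y 0 := by simp [er]; ring
  have c1 : (y + t • er y) 1 = (1 + t / rr y) * y 1 := by simp [er]; ring
  have cr : rr (y + t • er y) = (1 + t / rr y) * rr y := by
    conv_lhs => unfold rr
    rw [c0, c1]
    rw [show ((1 + t / rr y) * y 0) ^ 2 + ((1 + t / rr y) * y 1) ^ 2
      = ((1 + t / rr y) * rr y) ^ 2 by rw [mul_pow _ (rr y), rr_sq]; ring]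
    exact Real.sqrt_sq (by positivity)
  refine ⟨?_, ?_, ?_⟩
  · change 0 < rr _
    rw [cr]; positivity
  · rw [← h1]
    unfold er at c0 c1 cr ⊢
    rw [c0, c1, cr, mul_div_mul_left _ _ hp.ne', mul_div_mul_left _ _ hp.ne']
  · rw [← h2]
    unfold etheta
    rw [c0, c1, cr, ← mul_neg, mul_div_mul_left _ _ hp.ne', mul_div_mul_left _ _ hp.ne']

lemma HP_z {x y : R3} (hy : y ∈ HP x) (t : ℝ) : y + t • ez ∈ HP x := by
  obtain ⟨hU, h1, h2⟩ := hy
  have c0 : (y + t • ez) 0 = y 0 := by simp [ez]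
  have c1 : (y + t • ez) 1 = y 1 := by simp [ez]
  have cr : rr (y + t • ez) = rr y := by unfold rr; rw [c0, c1]
  refine ⟨?_, ?_, ?_⟩
  · change 0 < rr _; rw [cr]; exact hU
  · rw [← h1]; unfold er; rw [c0, c1, cr]
  · rw [← h2]; unfold etheta; rw [c0, c1, cr]

lemma Dv_congr {u v : R3 → ℝ} {y e : R3} (hu : DifferentiableAt ℝ u y) (hv : DifferentiableAt ℝ v y)
    (h : ∀ᶠ t : ℝ in nhds 0, u (y + t • e) = v (y + t • e)) : Dv e u y = Dv e v y := by
  have a := line_deriv (u := u) (x := y) (e := e) (t := 0) (by simpa using hu)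
  have b := line_deriv (u := v) (x := y) (e := e) (t := 0) (by simpa using hv)
  have := a.unique (b.congr_of_eventuallyEq h)
  simpa using this

lemma iter_r {u v : R3 → ℝ} {x : R3} (hu : ContDiff ℝ ∞ u) (hv : ContDiffOn ℝ ∞ v U)
    {k : ℝ} (h : ∀ y ∈ HP x, u y = k * v y) (a : ℕ) :
    ∀ y ∈ HP x, (Dv (er x))^[a] u y = k * dR^[a] v y := by
  induction a with
  | zero => exact h
  | succ n ih =>
    intro y hy
    rw [Function.iterate_succ_apply', Function.iterate_succ_apply', dR_eq, hy.2.1]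
    have hd : DifferentiableAt ℝ (dR^[n] v) y :=
      ((iter_on (fun u => dR_on) n hv).contDiffAt (isOpen_U.mem_nhds hy.1)).differentiableAt (by simp)
    rw [Dv_congr (v := fun z => k * dR^[n] v z) ((Dv_iter_smooth hu _ n).differentiable (by simp) y)
      (hd.const_mul k) (by filter_upwards [HP_r hy] with t ht using ih _ ht)]
    unfold Dv
    rw [fderiv_const_mul hd]; simp

lemma iter_z {u v : R3 → ℝ} {x : R3} (hu : ContDiff ℝ ∞ u) (hv : ContDiffOn ℝ ∞ v U)
    {k : ℝ} (h : ∀ y ∈ HP x, u y = k * v y) (a : ℕ) :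
    ∀ y ∈ HP x, (Dv ez)^[a] u y = k * dZ^[a] v y := by
  induction a with
  | zero => exact h
  | succ n ih =>
    intro y hy
    rw [Function.iterate_succ_apply', Function.iterate_succ_apply', dZ_eq]
    have hd : DifferentiableAt ℝ (dZ^[n] v) y :=
      ((iter_on (fun u hu => pd_on hu 2) n hv).contDiffAt (isOpen_U.mem_nhds hy.1)).differentiableAt (by simp)
    rw [Dv_congr (v := fun z => k * dZ^[n] v z) ((Dv_iter_smooth hu _ n).differentiable (by simp) y)
      (hd.const_mul k) (by filter_upwards with t using ih _ (HP_z hy t))]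
    unfold Dv
    rw [fderiv_const_mul hd]; simp

lemma sorted_eq {f : R3 → ℝ} (hf : ContDiff ℝ ∞ f) (ha : axisym f) {x : R3} (hx : x ∈ U) (a b c : ℕ) :
    (Dv ez)^[c] ((Dv (er x))^[a] ((Dv (etheta x))^[b] f)) x = coef b * Dop (b / 2) a c f x := by
  have hU : ContDiffOn ℝ ∞ f U := hf.contDiffOn
  have hq := iter_on (fun u => dRr_on) (b / 2) hU
  have h1 : ∀ y ∈ HP x, (Dv (etheta x))^[b] f y = coef b * dRr^[b / 2] f y := by
    intro y hy
    rw [← theta_iter b f hU ha y hy.1, line_iter hf, hy.2.2]; simp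
  have h2 := iter_r (Dv_iter_smooth hf _ b) hq h1 a
  exact iter_z (Dv_iter_smooth (Dv_iter_smooth hf _ b) _ a) (iter_on (fun u => dR_on) a hq) h2 c x
    ⟨hx, rfl, rfl⟩

lemma perm_sorted (L : List (Fin 3)) : L.Perm (List.replicate (L.count 2) 2 ++
    (List.replicate (L.count 0) 0 ++ List.replicate (L.count 1) 1)) := by
  rw [List.perm_iff_count]
  intro i
  fin_cases i <;> simp [List.count_replicate]

lemma itD_append (L M : List R3) (f : R3 → ℝ) : itD (L ++ M) f = itD L (itD M f) := by
  simp [itD]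

lemma main_eq {f : R3 → ℝ} (hf : ContDiff ℝ ∞ f) (ha : axisym f) {x : R3} (hx : x ∈ U)
    (m : ℕ) (ι : Fin m → Fin 3) :
    iteratedFDeriv ℝ m f x (fun i => frame x (ι i)) = coef ((List.ofFn ι).count 1) *
      Dop ((List.ofFn ι).count 1 / 2) ((List.ofFn ι).count 0) ((List.ofFn ι).count 2) f x := by
  rw [iter_itD hf, ← sorted_eq hf ha hx]
  have h : List.ofFn (fun i => frame x (ι i)) = (List.ofFn ι).map (frame x) := by
    rw [List.map_ofFn]; rfl
  rw [h, itD_perm hf ((perm_sorted _).map _)]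
  simp only [List.map_append, List.map_replicate, itD_append, itD_replicate]
  rfl

lemma count_total (L : List (Fin 3)) : L.count 0 + L.count 1 + L.count 2 = L.length := by
  have := (perm_sorted L).length_eq
  simp at this; omega

lemma coef_odd (b : ℕ) : b % 2 = 1 → coef b = 0 := by
  induction b using Nat.twoStepInduction with
  | zero => simp
  | one => simp [coef]
  | more n ih _ => intro h; rw [coef, ih (by omega)]; simp

lemma exists_iota {m : ℕ} {p : ℕ × ℕ × ℕ} (hp : p ∈ triples m) : ∃ ι : Fin m → Fin 3,
    (List.ofFn ι).count 1 = 2 * p.1 ∧ (List.ofFn ι).count 0 = p.2.1 ∧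
      (List.ofFn ι).count 2 = p.2.2 := by
  have h := (Finset.mem_filter.1 hp).2
  let L : List (Fin 3) := List.replicate (2 * p.1) 1 ++
    (List.replicate p.2.1 0 ++ List.replicate p.2.2 2)
  have hL : L.length = m := by simp [L]; omega
  subst hL
  refine ⟨L.get, ?_⟩
  rw [List.ofFn_get]
  simp [L, List.count_replicate]

/-- pointwise equivalence `|∇^m f|² ≃ Σ_{|𝔐|=m} (𝒟^𝔐 f)²` on `U`
for smooth axisymmetric `f`. -/
theorem stmt_5 (m : ℕ) :
    ∃ c C : ℝ, 0 < c ∧ 0 < C ∧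
      ∀ f : R3 → ℝ, ContDiff ℝ (⊤ : ℕ∞) f → axisym f → ∀ x ∈ U,
        c * (∑ p ∈ triples m, (Dop p.1 p.2.1 p.2.2 f x) ^ 2)
          ≤ ∑ ι : Fin m → Fin 3, (iteratedFDeriv ℝ m f x (fun i => frame x (ι i))) ^ 2 ∧
        ∑ ι : Fin m → Fin 3, (iteratedFDeriv ℝ m f x (fun i => frame x (ι i))) ^ 2
          ≤ C * (∑ p ∈ triples m, (Dop p.1 p.2.1 p.2.2 f x) ^ 2) := by
  refine ⟨1 / ((triples m).card + 1), Fintype.card (Fin m → Fin 3) *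
    (1 + ∑ b ∈ Finset.range (m + 1), coef b ^ 2) + 1, by positivity, by positivity, ?_⟩
  intro f hf ha x hx
  set S := ∑ ι : Fin m → Fin 3, (iteratedFDeriv ℝ m f x (fun i => frame x (ι i))) ^ 2 with hS
  set D := ∑ p ∈ triples m, (Dop p.1 p.2.1 p.2.2 f x) ^ 2 with hD
  have hS0 : 0 ≤ S := Finset.sum_nonneg fun _ _ => sq_nonneg _
  have hD0 : 0 ≤ D := Finset.sum_nonneg fun _ _ => sq_nonneg _
  constructor
  · have h1 : D ≤ ∑ p ∈ triples m, S := by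
      refine Finset.sum_le_sum fun p hp => ?_
      obtain ⟨ι, i1, i0, i2⟩ := exists_iota hp
      have hle : (iteratedFDeriv ℝ m f x (fun i => frame x (ι i))) ^ 2 ≤ S :=
        Finset.single_le_sum (f := fun ι : Fin m → Fin 3 =>
          (iteratedFDeriv ℝ m f x (fun i => frame x (ι i))) ^ 2)
          (fun _ _ => sq_nonneg _) (Finset.mem_univ ι)
      refine le_trans ?_ hle
      rw [main_eq hf ha hx, i1, i0, i2, mul_pow]
      have : 2 * p.1 / 2 = p.1 := by omega
      rw [this]
      exact le_mul_of_one_le_left (sq_nonneg _) (one_le_pow₀ (coef_even _))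
    rw [Finset.sum_const, nsmul_eq_mul] at h1
    rw [one_div_mul_eq_div, div_le_iff₀ (by positivity)]
    linarith
  · set K := ∑ b ∈ Finset.range (m + 1), coef b ^ 2 with hK
    have hK0 : 0 ≤ K := Finset.sum_nonneg fun _ _ => sq_nonneg _
    have h1 : S ≤ ∑ ι : Fin m → Fin 3, (1 + K) * D := by
      refine Finset.sum_le_sum fun ι _ => ?_
      rw [main_eq hf ha hx, mul_pow]
      have ht := count_total (List.ofFn ι)
      rw [List.length_ofFn] at ht
      generalize (List.ofFn ι).count 0 = a at *
      generalize (List.ofFn ι).count 1 = b at *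
      generalize (List.ofFn ι).count 2 = c at *
      rcases Nat.mod_two_eq_zero_or_one b with hb | hb
      · have hmem : (b / 2, a, c) ∈ triples m := by
          simp only [triples, Finset.mem_filter, Finset.mem_product, Finset.mem_range]
          omega
        have hle : (Dop (b / 2) a c f x) ^ 2 ≤ D :=
          Finset.single_le_sum (f := fun p : ℕ × ℕ × ℕ => (Dop p.1 p.2.1 p.2.2 f x) ^ 2)
            (fun _ _ => sq_nonneg _) hmem
        have hk : coef b ^ 2 ≤ K :=
          Finset.single_le_sum (f := fun b => coef b ^ 2)
            (fun _ _ => sq_nonneg _) (Finset.mem_range.2 (by omega))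
        exact mul_le_mul (by linarith) hle (sq_nonneg _) (by linarith)
      · rw [coef_odd b hb]; simp; positivity
    rw [Finset.sum_const, nsmul_eq_mul, Finset.card_univ] at h1
    linarith
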